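/- arXiv:2511.09324 — 2 statements merged into one kernel-verified Lean document; each statement's English description precedes it below -/
import Mathlib

section
/- Let S be a finite nonempty set of states and A = {0,1} the action set. For a state z ∈ S and subsidy λ ∈ ℝ, define the action gap f(λ) = Q̄_λ(z,1) − Q̄_λ(z,0), where Q̄_λ is the unique fixed point of the Bellman operator T_λ. Then for all λ, ν ∈ ℝ, |f(λ) − f(ν)| ≤ 2|λ − ν|/(1 − γ); in particular, the action gap is a continuous function of the subsidy λ. -/
open scoped BigOperators

/-- The single-arm Bellman operator with passivity subsidy `lam`. -/
noncomputable def bellman {S : Type*} [Fintype S]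
    (p : S × Fin 2 → S → ℝ) (r : S × Fin 2 → ℝ) (γ lam : ℝ)
    (Q : S × Fin 2 → ℝ) : S × Fin 2 → ℝ :=
  fun sa => r sa + lam * (1 - ((sa.2 : ℕ) : ℝ)) +
    γ * ∑ s' : S, p sa s' * max (Q (s', 0)) (Q (s', 1))

theorem abs_bellman_sub_bellman_le {S : Type*} [Fintype S]
    {p : S × Fin 2 → S → ℝ} (r : S × Fin 2 → ℝ) {γ : ℝ}
    (hp_nonneg : ∀ sa s', 0 ≤ p sa s') (hp_sum : ∀ sa, ∑ s' : S, p sa s' = 1)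
    (hγ0 : 0 ≤ γ) (lam nu : ℝ) (Q Q' : S × Fin 2 → ℝ) (sa : S × Fin 2) :
    |bellman p r γ lam Q sa - bellman p r γ nu Q' sa| ≤ |lam - nu| + γ * ‖Q - Q'‖ := by
  have hQ (x : S × Fin 2) : |Q x - Q' x| ≤ ‖Q - Q'‖ := by
    simpa using norm_le_pi_norm (Q - Q') x
  have hsum : |∑ s', p sa s' * (max (Q (s', 0)) (Q (s', 1)) - max (Q' (s', 0)) (Q' (s', 1)))|
      ≤ ‖Q - Q'‖ := by
    calc _ ≤ ∑ s', p sa s' * ‖Q - Q'‖ := by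
          refine (Finset.abs_sum_le_sum_abs _ _).trans (Finset.sum_le_sum fun s' _ => ?_)
          rw [abs_mul, abs_of_nonneg (hp_nonneg sa s')]
          exact mul_le_mul_of_nonneg_left
            ((abs_max_sub_max_le_max _ _ _ _).trans (max_le (hQ _) (hQ _))) (hp_nonneg sa s')
      _ = ‖Q - Q'‖ := by rw [← Finset.sum_mul, hp_sum, one_mul]
  have hpassive : |1 - ((sa.2 : ℕ) : ℝ)| ≤ 1 := by
    obtain ⟨s, a⟩ := sa
    fin_cases a <;> simp
  have hdiff : bellman p r γ lam Q sa - bellman p r γ nu Q' sa =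
      (lam - nu) * (1 - ((sa.2 : ℕ) : ℝ)) +
        γ * ∑ s', p sa s' * (max (Q (s', 0)) (Q (s', 1)) - max (Q' (s', 0)) (Q' (s', 1))) := by
    simp only [bellman, mul_sub, Finset.sum_sub_distrib]
    ring
  rw [hdiff]
  refine (abs_add_le _ _).trans (add_le_add ?_ ?_)
  · rw [abs_mul]
    exact mul_le_of_le_one_right (abs_nonneg _) hpassive
  · rw [abs_mul, abs_of_nonneg hγ0]
    exact mul_le_mul_of_nonneg_left hsum hγ0

theorem norm_sub_le_of_bellman_eq_self {S : Type*} [Fintype S]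
    {p : S × Fin 2 → S → ℝ} {r : S × Fin 2 → ℝ} {γ : ℝ}
    (hp_nonneg : ∀ sa s', 0 ≤ p sa s') (hp_sum : ∀ sa, ∑ s' : S, p sa s' = 1)
    (hγ0 : 0 ≤ γ) (hγ1 : γ < 1) {lam nu : ℝ} {Q Q' : S × Fin 2 → ℝ}
    (hQ : bellman p r γ lam Q = Q) (hQ' : bellman p r γ nu Q' = Q') :
    ‖Q - Q'‖ ≤ |lam - nu| / (1 - γ) := by
  have h : ‖Q - Q'‖ ≤ |lam - nu| + γ * ‖Q - Q'‖ := by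
    refine (pi_norm_le_iff_of_nonneg (by positivity)).2 fun sa => ?_
    simpa [hQ, hQ'] using abs_bellman_sub_bellman_le r hp_nonneg hp_sum hγ0 lam nu Q Q' sa
  rw [le_div_iff₀ (sub_pos.2 hγ1)]
  linarith

/-- the action gap `f(lam) = Q̄_lam(z,1) − Q̄_lam(z,0)` satisfies
`|f(lam) − f(nu)| ≤ 2|lam − nu|/(1 − γ)`; in particular it is continuous in `lam`. -/
theorem action_gap_lipschitz {S : Type*} [Fintype S] [Nonempty S]
    (p : S × Fin 2 → S → ℝ) (r : S × Fin 2 → ℝ) (γ : ℝ)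
    (hp_nonneg : ∀ sa s', 0 ≤ p sa s')
    (hp_sum : ∀ sa, ∑ s' : S, p sa s' = 1)
    (hγ0 : 0 ≤ γ) (hγ1 : γ < 1)
    (z : S) (Qbar : ℝ → (S × Fin 2 → ℝ))
    (hQbar : ∀ lam : ℝ, bellman p r γ lam (Qbar lam) = Qbar lam) :
    (∀ lam nu : ℝ,
      |(Qbar lam (z, 1) - Qbar lam (z, 0)) - (Qbar nu (z, 1) - Qbar nu (z, 0))|
        ≤ 2 * |lam - nu| / (1 - γ)) ∧
    Continuous (fun lam : ℝ => Qbar lam (z, 1) - Qbar lam (z, 0)) := by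
  have hgap (lam nu : ℝ) :
      |(Qbar lam (z, 1) - Qbar lam (z, 0)) - (Qbar nu (z, 1) - Qbar nu (z, 0))|
        ≤ 2 * |lam - nu| / (1 - γ) := by
    have hQ (sa : S × Fin 2) : |Qbar lam sa - Qbar nu sa| ≤ |lam - nu| / (1 - γ) :=
      (norm_le_pi_norm (Qbar lam - Qbar nu) sa).trans
        (norm_sub_le_of_bellman_eq_self hp_nonneg hp_sum hγ0 hγ1 (hQbar lam) (hQbar nu))
    rw [sub_sub_sub_comm, mul_div_assoc, two_mul]
    exact (abs_sub _ _).trans (add_le_add (hQ _) (hQ _))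
  refine ⟨hgap, (LipschitzWith.of_dist_le' (K := 2 / (1 - γ)) fun lam nu => ?_).continuous⟩
  rw [Real.dist_eq, Real.dist_eq, div_mul_eq_mul_div]
  exact hgap lam nu
end

section
/- Let y_k be a real sequence satisfying y_{k+1} = y_k + β_k g_k with β_k ≥ 0, sup_k β_k ≤ B < ∞, and |g_k| ≤ G < ∞ for all k. Suppose there exist c⁻ ≤ c⁺ in ℝ, η > 0, and k₀ ∈ ℕ such that for all k ≥ k₀: y_k > c⁺ implies g_k ≤ −η/2, and y_k < c⁻ implies g_k ≥ η/2. Then sup_k |y_k| < ∞. -/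
/-- boundedness of the slow iterates. If `y_{k+1} = y_k + β_k g_k`
with `0 ≤ β_k ≤ B`, `|g_k| ≤ G`, and from some time `k₀` onward the drift points
inward outside `[c⁻, c⁺]` with magnitude at least `η/2`, then `sup_k |y_k| < ∞`. -/
theorem slow_iterates_bounded
    (β g y : ℕ → ℝ) (B G cminus cplus η : ℝ) (k₀ : ℕ)
    (hβ : ∀ k, 0 ≤ β k) (hB : ∀ k, β k ≤ B)
    (hG : ∀ k, |g k| ≤ G)
    (hc : cminus ≤ cplus) (hη : 0 < η)
    (hy : ∀ k, y (k + 1) = y k + β k * g k)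
    (hdrift_up : ∀ k, k₀ ≤ k → cplus < y k → g k ≤ -(η / 2))
    (hdrift_down : ∀ k, k₀ ≤ k → y k < cminus → η / 2 ≤ g k) :
    ∃ C : ℝ, ∀ k, |y k| ≤ C := by
  have hstep : ∀ k, |β k * g k| ≤ B * G := fun k => by
    rw [abs_mul, abs_of_nonneg (hβ k)]
    exact mul_le_mul (hB k) (hG k) (abs_nonneg _) ((hβ k).trans (hB k))
  have htail : ∀ n, |y (k₀ + n)| ≤ |y k₀| + |cminus| + |cplus| + B * G := by
    have hBG : 0 ≤ B * G := (abs_nonneg _).trans (hstep 0)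
    have h₁ := abs_nonneg (y k₀)
    have h₂ := abs_le.1 (le_refl |cminus|)
    have h₃ := abs_le.1 (le_refl |cplus|)
    intro n
    induction n with
    | zero => rw [add_zero]; linarith
    | succ n ih =>
      have hs := abs_le.1 (hstep (k₀ + n))
      rw [← add_assoc, hy]
      rw [abs_le] at ih ⊢
      rcases lt_or_ge cplus (y (k₀ + n)) with hp | hp
      · have hd : β (k₀ + n) * g (k₀ + n) ≤ 0 :=
          mul_nonpos_of_nonneg_of_nonpos (hβ _)
            (by linarith [hdrift_up _ (Nat.le_add_right k₀ n) hp])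
        constructor <;> linarith
      · rcases lt_or_ge (y (k₀ + n)) cminus with hm | hm
        · have hd : 0 ≤ β (k₀ + n) * g (k₀ + n) :=
            mul_nonneg (hβ _) (by linarith [hdrift_down _ (Nat.le_add_right k₀ n) hm])
          constructor <;> linarith
        · constructor <;> linarith
  refine ⟨|y k₀| + |cminus| + |cplus| + B * G + ∑ i ∈ Finset.range k₀, |y i|, fun k => ?_⟩
  rcases lt_or_ge k k₀ with hk | hk
  · have hle := Finset.single_le_sum (f := fun i => |y i|) (fun i _ => abs_nonneg _)
      (Finset.mem_range.2 hk)
    have h₀ := (abs_nonneg _).trans (htail 0)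
    linarith
  · obtain ⟨n, rfl⟩ := Nat.exists_eq_add_of_le hk
    have h₀ := Finset.sum_nonneg (s := Finset.range k₀) fun i _ => abs_nonneg (y i)
    linarith [htail n]
end
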